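/- Fix W(0), W ∈ (ℝ^d)^m, a ∈ {−1,+1}^m, x ∈ ℝ^d with ‖x‖₂ ≤ 1, and λ > 0, and suppose max_{i≤m} ‖W_i − W_i(0)‖₂ ≤ λ/√m. Then |(∇_W Q(x;W(0),a) − ∇_W Q(x;W,a))ᵀ W(0)| ≤ (λ/m) · |{ i : |W_i(0)ᵀx| ≤ λ/√m }|. -/

import Mathlib

open MeasureTheory ProbabilityTheory Finset
open scoped ENNReal

noncomputable section

/-- Dot product on `Fin d → ℝ`. -/
def dotp {d : ℕ} (w x : Fin d → ℝ) : ℝ := ∑ j, w j * x j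

/-- Euclidean norm on `Fin d → ℝ`. -/
def vnorm {d : ℕ} (w : Fin d → ℝ) : ℝ := Real.sqrt (∑ j, w j ^ 2)

/-- Standard Gaussian `N(0, I_d)` on `Fin d → ℝ`. -/
def stdGaussian (d : ℕ) : Measure (Fin d → ℝ) := Measure.pi fun _ => gaussianReal 0 1

/-- Uniform distribution on `{-1, +1} ⊆ ℝ`. -/
def pmOne : Measure ℝ := (2 : ℝ≥0∞)⁻¹ • Measure.dirac 1 + (2 : ℝ≥0∞)⁻¹ • Measure.dirac (-1)

/-- Two-layer ReLU network `Q(x; W, a)` of width `m`. -/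
def netQ {d : ℕ} (m : ℕ) (x : Fin d → ℝ) (W : ℕ → Fin d → ℝ) (a : ℕ → ℝ) : ℝ :=
  (Real.sqrt m)⁻¹ * ∑ i ∈ Finset.range m, a i * max (dotp (W i) x) 0

/-- The pairing `∇_W Q(x; W, a)ᵀ U = (1/√m) Σ_i a_i 1{W_iᵀx ≥ 0} U_iᵀ x`. -/
def gradDot {d : ℕ} (m : ℕ) (x : Fin d → ℝ) (W U : ℕ → Fin d → ℝ) (a : ℕ → ℝ) : ℝ :=
  (Real.sqrt m)⁻¹ * ∑ i ∈ Finset.range m,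
    a i * (if 0 ≤ dotp (W i) x then dotp (U i) x else 0)

/-- `‖f‖_π = (∫ f² dπ)^{1/2}`. -/
def pnorm {X : Type*} [MeasurableSpace X] (π : Measure X) (f : X → ℝ) : ℝ :=
  Real.sqrt (∫ x, f x ^ 2 ∂π)

/-- `ℓ(m, δ) = 4√(d log(2m+1)) + 4√(log(1/δ))`. -/
def ellBound (d m : ℕ) (δ : ℝ) : ℝ :=
  4 * Real.sqrt (d * Real.log (2 * m + 1)) + 4 * Real.sqrt (Real.log (1 / δ))

/-- The reference point `W̄ = (W_i(0) + a_i v(W_i(0)) / √m)_i`. -/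
def WbarDef {d : ℕ} (m : ℕ) (a : ℕ → ℝ) (W0 : ℕ → Fin d → ℝ)
    (v : (Fin d → ℝ) → Fin d → ℝ) : ℕ → Fin d → ℝ :=
  fun i j => W0 i j + a i * v (W0 i) j / Real.sqrt m

/-- Squared Euclidean norm of the concatenation, `‖W - W'‖₂²`. -/
def diffSq {d : ℕ} (m : ℕ) (W W' : ℕ → Fin d → ℝ) : ℝ :=
  ∑ i ∈ Finset.range m, ∑ j, (W i j - W' i j) ^ 2

/-- The event `{t < t₁}`: all iterates up to time `t` stay within `λ/√m` of initialization. -/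
def inBallUpTo {d : ℕ} (m : ℕ) (lam : ℝ) (W : ℕ → ℕ → Fin d → ℝ)
    (W0 : ℕ → Fin d → ℝ) (t : ℕ) : Prop :=
  ∀ s ≤ t, ∀ i < m, vnorm (fun j => W s i j - W0 i j) ≤ lam / Real.sqrt m

/-- The event `E₁`. -/
def E1ev {d : ℕ} (m : ℕ) (lam ℓ : ℝ) (Xs : Set (Fin d → ℝ)) (W0 : ℕ → Fin d → ℝ) : Prop :=
  ∀ x ∈ Xs, (m : ℝ)⁻¹ * ∑ i ∈ Finset.range m,
      (if |dotp (W0 i) x| ≤ lam / Real.sqrt m then (1 : ℝ) else 0)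
    ≤ (lam + ℓ) / Real.sqrt m

/-- Cauchy–Schwarz for `dotp` and `vnorm`. -/
theorem abs_dotp_le_aux {d : ℕ} (w x : Fin d → ℝ) : |dotp w x| ≤ vnorm w * vnorm x := by
  unfold dotp vnorm
  rw [← Real.sqrt_mul (Finset.sum_nonneg fun j _ => sq_nonneg (w j))]
  exact Real.abs_le_sqrt (Finset.sum_mul_sq_le_sq_mul_sq _ _ _)

/-- Gradient-difference pairing with `W(0)`. -/
theorem grad_diff_pairing_W0
    {d : ℕ} (m : ℕ) (hm : 1 ≤ m) (W0 W : ℕ → Fin d → ℝ) (a : ℕ → ℝ)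
    (ha : ∀ i < m, a i = 1 ∨ a i = -1) (x : Fin d → ℝ) (hx : vnorm x ≤ 1)
    {lam : ℝ} (hlam : 0 < lam)
    (hball : ∀ i < m, vnorm (fun j => W i j - W0 i j) ≤ lam / Real.sqrt m) :
    |gradDot m x W0 W0 a - gradDot m x W W0 a|
      ≤ lam / m * ∑ i ∈ Finset.range m,
          (if |dotp (W0 i) x| ≤ lam / Real.sqrt m then (1 : ℝ) else 0) := by
  have hmpos : (0 : ℝ) < m := by exact_mod_cast hm
  have hs : 0 < Real.sqrt m := Real.sqrt_pos.mpr hmpos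
  have hss : lam / m = (Real.sqrt m)⁻¹ * (lam / Real.sqrt m) := by
    have h := Real.mul_self_sqrt hmpos.le
    field_simp
    rw [pow_two, h]
  have hc : 0 < lam / Real.sqrt m := div_pos hlam hs
  unfold gradDot
  rw [← mul_sub, abs_mul, abs_of_pos (inv_pos.mpr hs), hss, mul_assoc]
  refine mul_le_mul_of_nonneg_left ?_ (inv_pos.mpr hs).le
  rw [← Finset.sum_sub_distrib, Finset.mul_sum]
  refine (Finset.abs_sum_le_sum_abs _ _).trans (Finset.sum_le_sum fun i hi => ?_)
  have him : i < m := Finset.mem_range.mp hi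
  have hsub : dotp (fun j => W i j - W0 i j) x = dotp (W i) x - dotp (W0 i) x := by
    simp only [dotp, sub_mul, Finset.sum_sub_distrib]
  have hd : |dotp (W i) x - dotp (W0 i) x| ≤ lam / Real.sqrt m := by
    rw [← hsub]
    refine (abs_dotp_le_aux _ _).trans ?_
    calc _ ≤ vnorm (fun j => W i j - W0 i j) * 1 :=
          mul_le_mul_of_nonneg_left hx (Real.sqrt_nonneg _)
      _ ≤ _ := by rw [mul_one]; exact hball i him
  have ha1 : |a i| = 1 := by
    rcases ha i him with h | h <;> simp [h]
  rw [← mul_sub, abs_mul, ha1, one_mul]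
  generalize dotp (W i) x = p at *
  generalize dotp (W0 i) x = q at *
  generalize lam / Real.sqrt m = c at *
  have h2 := abs_le.mp hd
  by_cases hq : |q| ≤ c
  · rw [if_pos hq, mul_one]
    split_ifs <;> simp <;> first | exact hc.le | exact hq
  · rw [if_neg hq, mul_zero]
    rcases lt_abs.mp (not_le.mp hq) with h | h
    · rw [if_pos (by linarith), if_pos (by linarith)]; simp
    · rw [if_neg (by linarith), if_neg (by linarith)]; simp

end
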